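/- arXiv:1410.3530 — 12 statements merged into one kernel-verified Lean document; each statement's English description precedes it below -/
import Mathlib

section
/- Let G be a group, let d ≥ 3, and let s₀, s₁, …, s_{d−1} ∈ G (indices read modulo d) satisfy: (i) s_a·s_{a+1}·s_a = s_{a+1}·s_a·s_{a+1} for every a, and (ii) s_a·s_b = s_b·s_a whenever a and b are not cyclically adjacent (i.e. b ≢ a−1, a, a+1 mod d). For each a define p(a) = s_{a+1}⁻¹·s_{a+2}⁻¹ ⋯ s_{a+d−2}⁻¹ · s_{a+d−1} · s_{a+d−2} ⋯ s_{a+1} (indices mod d). If s_a·p(a) = p(a)·s_a holds for some index a, then s_b·p(b) = p(b)·s_b holds for every index b. -/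
def cycP {G : Type*} [Group G] (t : ℕ → G) (m : ℕ) : G :=
  ((List.range m).reverse.map t).prod

theorem cycP_succ {G : Type*} [Group G] (t : ℕ → G) (m : ℕ) :
    cycP t (m + 1) = t m * cycP t m := by
  simp [cycP, List.range_succ]

theorem cycP_inv {G : Type*} [Group G] (t : ℕ → G) (m : ℕ) :
    ((List.range m).map (fun j => (t j)⁻¹)).prod = (cycP t m)⁻¹ := by
  induction m with
  | zero => simp [cycP]
  | succ k ih => rw [cycP_succ, mul_inv_rev, ← ih, List.range_succ]; simp

theorem cycP_commute {G : Type*} [Group G] (t : ℕ → G) (g : G) (m : ℕ)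
    (h : ∀ i < m, Commute g (t i)) : Commute g (cycP t m) := by
  induction m with
  | zero => simp [cycP]
  | succ k ih =>
    rw [cycP_succ]
    exact (h k (by omega)).mul_right (ih fun i hi => h i (by omega))

theorem cycP_conj {G : Type*} [Group G] (t : ℕ → G) (m : ℕ)
    (hb : ∀ i < m, t i * t (i + 1) * t i = t (i + 1) * t i * t (i + 1))
    (hc : ∀ i j, i + 2 ≤ j → j ≤ m → Commute (t j) (t i)) :
    (cycP t m)⁻¹ * t m * cycP t m =
      cycP (fun i => t (i + 1)) m * t 0 * (cycP (fun i => t (i + 1)) m)⁻¹ := by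
  induction m with
  | zero => simp [cycP]
  | succ k ih =>
    have ih := ih (fun i hi => hb i (by omega)) (fun i j h1 h2 => hc i j h1 (by omega))
    have hk := hb k (by omega)
    have hcm : Commute (t (k + 1)) (cycP t k) :=
      cycP_commute t _ k fun i hi => hc i (k + 1) (by omega) le_rfl
    have e : (t k)⁻¹ * t (k + 1) * t k = t (k + 1) * t k * (t (k + 1))⁻¹ := by
      rw [eq_mul_inv_iff_mul_eq, mul_assoc, mul_assoc, inv_mul_eq_iff_eq_mul, ← mul_assoc,
        ← mul_assoc, hk]
    rw [cycP_succ, cycP_succ]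
    calc (t k * cycP t k)⁻¹ * t (k + 1) * (t k * cycP t k)
        = (cycP t k)⁻¹ * ((t k)⁻¹ * t (k + 1) * t k) * cycP t k := by group
      _ = ((cycP t k)⁻¹ * t (k + 1)) * t k * ((t (k + 1))⁻¹ * cycP t k) := by rw [e]; group
      _ = (t (k + 1) * (cycP t k)⁻¹) * t k * (cycP t k * (t (k + 1))⁻¹) := by
          rw [hcm.inv_right.eq, hcm.inv_left.eq]
      _ = t (k + 1) * ((cycP t k)⁻¹ * t k * cycP t k) * (t (k + 1))⁻¹ := by group
      _ = _ := by rw [ih]; group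

/-- For a chordless cycle with all edges of weight 1, a single cycle relation
`s_a · p(a) = p(a) · s_a` implies all of them, given the braid relations between
cyclically adjacent generators and commutation between non-adjacent generators. -/
theorem cycle_relation_propagates {G : Type*} [Group G] (d : ℕ) (hd : 3 ≤ d)
    (s : ZMod d → G)
    (hbraid : ∀ a : ZMod d, s a * s (a + 1) * s a = s (a + 1) * s a * s (a + 1))
    (hcomm : ∀ a b : ZMod d, b ≠ a - 1 → b ≠ a → b ≠ a + 1 → s a * s b = s b * s a)
    (p : ZMod d → G)
    (hp : ∀ a : ZMod d, p a =
      (((List.range (d - 2)).map (fun j => (s (a + ((j + 1 : ℕ) : ZMod d)))⁻¹)).prod) *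
        s (a + ((d - 1 : ℕ) : ZMod d)) *
      (((List.range (d - 2)).reverse.map (fun j => s (a + ((j + 1 : ℕ) : ZMod d)))).prod))
    (a : ZMod d) (ha : s a * p a = p a * s a) :
    ∀ b : ZMod d, s b * p b = p b * s b := by
  have step : ∀ a : ZMod d, s a * p a = p a * s a →
      s (a + 1) * p (a + 1) = p (a + 1) * s (a + 1) := by
    intro a ha
    obtain ⟨m, rfl⟩ : ∃ m, d = m + 2 := ⟨d - 2, by omega⟩
    set t : ℕ → G := fun j => s (a + ((j + 1 : ℕ) : ZMod (m + 2))) with ht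
    have hm0 : ((m : ZMod (m + 2)) + 2) = 0 := by
      have := ZMod.natCast_self (m + 2)
      push_cast at this
      exact this
    have key := cycP_conj t m
      (fun i _ => by
        have := hbraid (a + ((i + 1 : ℕ) : ZMod (m + 2)))
        simp only [ht]
        push_cast at this ⊢
        simpa only [add_assoc] using this)
      (fun i j hij hj => by
        have hne : ∀ r : ℕ, 0 < r → r < m + 2 → ((r : ℕ) : ZMod (m + 2)) ≠ 0 := by
          intro r h0 h1 h
          rw [ZMod.natCast_eq_zero_iff] at h
          exact absurd (Nat.le_of_dvd h0 h) (by omega)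
        obtain ⟨k, rfl⟩ : ∃ k, j = i + 2 + k := ⟨j - (i + 2), by omega⟩
        apply hcomm
        · intro h
          apply hne (k + 1) (by omega) (by omega)
          push_cast at h ⊢
          linear_combination -h
        · intro h
          apply hne (k + 2) (by omega) (by omega)
          push_cast at h ⊢
          linear_combination -h
        · intro h
          apply hne (k + 3) (by omega) (by omega)
          push_cast at h ⊢
          linear_combination -h)
    have p0 : p a = (cycP t m)⁻¹ * t m * cycP t m := by
      rw [hp a, ← cycP_inv]
      rfl
    have hsh : (fun j : ℕ => s (a + 1 + ((j + 1 : ℕ) : ZMod (m + 2)))) = fun i => t (i + 1) := by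
      funext j
      simp only [ht]
      congr 1
      push_cast
      ring
    have p1 : p (a + 1) = (cycP (fun i => t (i + 1)) m)⁻¹ * s a * cycP (fun i => t (i + 1)) m := by
      rw [hp (a + 1), ← hsh, ← cycP_inv]
      have : a + 1 + ((m + 2 - 1 : ℕ) : ZMod (m + 2)) = a := by
        rw [show m + 2 - 1 = m + 1 by omega]
        push_cast
        linear_combination hm0
      rw [this]
      rfl
    have t0 : t 0 = s (a + 1) := by simp [ht]
    rw [p0, key, t0] at ha
    rw [p1]
    generalize cycP (fun i => t (i + 1)) m = W at *
    calc s (a + 1) * (W⁻¹ * s a * W)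
        = W⁻¹ * (W * s (a + 1) * W⁻¹ * s a) * W := by group
      _ = _ := by rw [← ha]; group
  have all : ∀ n : ℕ, s (a + n) * p (a + n) = p (a + n) * s (a + n) := by
    intro n
    induction n with
    | zero => simpa using ha
    | succ k ih =>
      have := step _ ih
      push_cast
      rwa [← add_assoc]
  intro b
  haveI : NeZero d := ⟨by omega⟩
  have := all (b - a).val
  rwa [ZMod.natCast_zmod_val, add_sub_cancel] at this
end

section
/- Let G be a group and let x, y, z ∈ G satisfy x·y·x = y·x·y, y·z·y·z = z·y·z·y, and z·x·z·x = x·z·x·z. Then x commutes with y⁻¹·z·y if and only if z commutes with x⁻¹·y·x. -/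
theorem triangle_cycle_relations_equiv {G : Type*} [Group G] (x y z : G)
    (hxy : x * y * x = y * x * y)
    (hyz : y * z * y * z = z * y * z * y)
    (hzx : z * x * z * x = x * z * x * z) :
    (x * (y⁻¹ * z * y) = (y⁻¹ * z * y) * x) ↔
      (z * (x⁻¹ * y * x) = (x⁻¹ * y * x) * z) := by
  have h : x⁻¹ * y * x = y * x * y⁻¹ := by
    rw [eq_mul_inv_iff_mul_eq, mul_assoc, mul_assoc, inv_mul_eq_iff_eq_mul]
    simpa only [mul_assoc] using hxy.symm
  rw [h]
  constructor
  · intro e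
    have e2 := congrArg (fun t => y * t * y⁻¹) e
    simp only [mul_assoc, mul_inv_cancel_left, mul_inv_cancel, mul_one] at e2
    simpa only [mul_assoc] using e2.symm
  · intro e
    have e2 := congrArg (fun t => y⁻¹ * t * y) e
    simp only [mul_assoc, inv_mul_cancel_left, inv_mul_cancel, mul_one] at e2
    simpa only [mul_assoc] using e2.symm
end

section
/- Let G be a group and let x, y, z ∈ G satisfy x·y·x = y·x·y, y·z·y·z = z·y·z·y, z·x·z·x = x·z·x·z, and suppose x commutes with y⁻¹·z·y. Then y·z⁻¹·x·z·y·z⁻¹·x⁻¹·z·y⁻¹·z⁻¹·x⁻¹·z = e. -/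
theorem tri_aux {G : Type*} [Group G] (x y w : G) (h1 : x*y*x = y*x*y)
    (h2 : y*w*y*w = w*y*w*y) (h3 : x*w = w*x) :
    y * ((y*w*y⁻¹)⁻¹*x*(y*w*y⁻¹)) * y =
     ((y*w*y⁻¹)⁻¹*x*(y*w*y⁻¹)) * y * ((y*w*y⁻¹)⁻¹*x*(y*w*y⁻¹)) := by
  obtain ⟨z, hz⟩ : ∃ z, z = y*w*y⁻¹ := ⟨_, rfl⟩
  rw [← hz]
  obtain ⟨g, hg⟩ : ∃ g, g = z⁻¹*(y*x*w*y) := ⟨_, rfl⟩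
  obtain ⟨v, hv⟩ : ∃ v, v = w*y*w⁻¹ := ⟨_, rfl⟩
  have h3' : w⁻¹*x = x*w⁻¹ := by
    rw [inv_mul_eq_iff_eq_mul, ← mul_assoc, ← h3]; group
  have e1 : g*x*g⁻¹ = y := by
    rw [mul_inv_eq_iff_eq_mul]
    have a : z*y*z⁻¹ = y*v*y⁻¹ := by rw [hz, hv]; group
    have b : x*w*y*x = v*x*w*y := by
      calc x*w*y*x = w*(x*y*x) := by rw [h3]; group
        _ = w*y*(x*w⁻¹)*w*y := by rw [h1]; group
        _ = v*x*w*y := by rw [← h3', hv]; group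
    calc g*x = z⁻¹*(y*(x*w*y*x)) := by rw [hg]; group
      _ = z⁻¹*(y*v*y⁻¹)*y*x*w*y := by rw [b]; group
      _ = y*g := by rw [← a, hg]; group
  have e2 : g*v*g⁻¹ = z⁻¹*x*z := by
    rw [mul_inv_eq_iff_eq_mul]
    calc g*v = z⁻¹*(y*x*(w*y*w*y)*w⁻¹) := by rw [hg, hv]; group
      _ = z⁻¹*((y*x*y)*w*y) := by rw [← h2]; group
      _ = z⁻¹*x*z*g := by rw [← h1, hg]; group
  have e3 : x*v*x = v*x*v := by
    calc x*v*x = (x*w)*y*(w⁻¹*x) := by rw [hv]; group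
      _ = w*(x*y*x)*w⁻¹ := by rw [h3, h3']; group
      _ = w*y*(x*w⁻¹)*w*y*w⁻¹ := by rw [h1]; group
      _ = v*x*v := by rw [← h3', hv]; group
  rw [← e2]
  calc y*(g*v*g⁻¹)*y = g*x*g⁻¹*(g*v*g⁻¹)*(g*x*g⁻¹) := by rw [e1]
    _ = g*(x*v*x)*g⁻¹ := by group
    _ = g*v*g⁻¹*(g*x*g⁻¹)*(g*v*g⁻¹) := by rw [e3]; group
    _ = _ := by rw [e1]

theorem triangle_extra_relation {G : Type*} [Group G] (x y z : G)
    (hxy : x * y * x = y * x * y)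
    (hyz : y * z * y * z = z * y * z * y)
    (hzx : z * x * z * x = x * z * x * z)
    (hc : x * (y⁻¹ * z * y) = (y⁻¹ * z * y) * x) :
    y * z⁻¹ * x * z * y * z⁻¹ * x⁻¹ * z * y⁻¹ * z⁻¹ * x⁻¹ * z = 1 := by

  have h2 : y*(y⁻¹*z*y)*y*(y⁻¹*z*y) = (y⁻¹*z*y)*y*(y⁻¹*z*y)*y := by
    calc y*(y⁻¹*z*y)*y*(y⁻¹*z*y) = y⁻¹*(y*z*y*z)*y := by group
      _ = _ := by rw [hyz]; group
  have key := tri_aux x y (y⁻¹*z*y) hxy h2 hc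
  have hz : y*(y⁻¹*z*y)*y⁻¹ = z := by group
  rw [hz] at key
  calc _ = (y * (z⁻¹*x*z) * y) * ((z⁻¹*x*z) * y * (z⁻¹*x*z))⁻¹ := by group
    _ = 1 := by rw [key, mul_inv_cancel]
end

section
/- Let G be a group and let a, b, c, d ∈ G satisfy a·b·a = b·a·b, b·c·b·c = c·b·c·b, c·d·c = d·c·d, d·a·d·a = a·d·a·d, a·c = c·a, and b·d = d·b. Then a commutes with b⁻¹·c⁻¹·d·c·b if and only if c commutes with d⁻¹·a⁻¹·b·a·d. -/
theorem square_cycle_relations_equiv {G : Type*} [Group G] (a b c d : G)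
    (hab : a * b * a = b * a * b)
    (hbc : b * c * b * c = c * b * c * b)
    (hcd : c * d * c = d * c * d)
    (hda : d * a * d * a = a * d * a * d)
    (hac : a * c = c * a)
    (hbd : b * d = d * b) :
    (a * (b⁻¹ * c⁻¹ * d * c * b) = (b⁻¹ * c⁻¹ * d * c * b) * a) ↔
      (c * (d⁻¹ * a⁻¹ * b * a * d) = (d⁻¹ * a⁻¹ * b * a * d) * c) := by 
  have h1 : c⁻¹ * d * c = d * c * d⁻¹ := by
    rw [eq_mul_inv_iff_mul_eq]
    simp only [mul_assoc] at hcd ⊢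
    rw [inv_mul_eq_iff_eq_mul, ← hcd]
  have h2 : a⁻¹ * b * a = b * a * b⁻¹ := by
    rw [eq_mul_inv_iff_mul_eq]
    simp only [mul_assoc] at hab ⊢
    rw [inv_mul_eq_iff_eq_mul, ← hab]
  have hc : Commute b d := hbd
  have hX : b⁻¹ * c⁻¹ * d * c * b = (b * d⁻¹)⁻¹ * c * (b * d⁻¹) := by
    calc _ = b⁻¹ * (c⁻¹ * d * c) * b := by group
      _ = (b⁻¹ * d) * c * (d⁻¹ * b) := by rw [h1]; group
      _ = (d * b⁻¹) * c * (b * d⁻¹) := by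
        rw [hc.inv_left.eq, hc.inv_right.eq]
      _ = _ := by group
  have hY : d⁻¹ * a⁻¹ * b * a * d = (b * d⁻¹) * a * (b * d⁻¹)⁻¹ := by
    calc _ = d⁻¹ * (a⁻¹ * b * a) * d := by group
      _ = (d⁻¹ * b) * a * (b⁻¹ * d) := by rw [h2]; group
      _ = (b * d⁻¹) * a * (d * b⁻¹) := by
        rw [hc.inv_left.eq, hc.inv_right.eq]
      _ = _ := by group
  rw [hX, hY]
  generalize b * d⁻¹ = g
  constructor
  · intro h
    calc _ = g * ((g⁻¹ * c * g) * a) * g⁻¹ := by group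
      _ = g * (a * (g⁻¹ * c * g)) * g⁻¹ := by rw [h]
      _ = _ := by group
  · intro h
    calc _ = g⁻¹ * ((g * a * g⁻¹) * c) * g := by group
      _ = g⁻¹ * (c * (g * a * g⁻¹)) * g := by rw [h]
      _ = _ := by group
end

section
/- Let G be a group, let d ≥ 3, and let s₀, s₁, …, s_{d−1} ∈ G (indices read modulo d) satisfy: (i) s_a·s_{a+1}·s_a = s_{a+1}·s_a·s_{a+1} for every a, and (ii) s_a·s_b = s_b·s_a whenever a and b are not cyclically adjacent. Suppose moreover that s₀ commutes with s₁⁻¹·s₂⁻¹ ⋯ s_{d−2}⁻¹ · s_{d−1} · s_{d−2} ⋯ s₂·s₁. Then s₀ commutes with s_{d−1}·s_{d−2} ⋯ s₂ · s₁ · s₂⁻¹ ⋯ s_{d−2}⁻¹·s_{d−1}⁻¹. -/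
theorem cyc_aux {G : Type*} [Group G] (t : ℕ → G) (m : ℕ)
    (hb : ∀ i, i < m → t i * t (i + 1) * t i = t (i + 1) * t i * t (i + 1))
    (hk : ∀ i j, i + 2 ≤ j → j ≤ m → Commute (t j) (t i)) :
    ((List.range m).map (fun j => (t j)⁻¹)).prod * t m *
      ((List.range m).reverse.map (fun j => t j)).prod =
    ((List.range m).reverse.map (fun j => t (j + 1))).prod * t 0 *
      ((List.range m).map (fun j => (t (j + 1))⁻¹)).prod := by
  induction m with
  | zero => simp
  | succ m ih =>
    have ih := ih (fun i hi => hb i (by omega)) (fun i j h1 h2 => hk i j h1 (by omega))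
    have c1 : Commute (t (m + 1)) ((List.range m).map (fun j => (t j)⁻¹)).prod := by
      apply Commute.list_prod_right
      intro x hx
      simp only [List.mem_map, List.mem_range] at hx
      obtain ⟨j, hj, rfl⟩ := hx
      exact (hk j (m + 1) (by omega) le_rfl).inv_right
    have c2 : Commute (t (m + 1)) ((List.range m).reverse.map (fun j => t j)).prod := by
      apply Commute.list_prod_right
      intro x hx
      simp only [List.mem_map, List.mem_reverse, List.mem_range] at hx
      obtain ⟨j, hj, rfl⟩ := hx
      exact hk j (m + 1) (by omega) le_rfl
    have b : (t m)⁻¹ * t (m + 1) * t m = t (m + 1) * t m * (t (m + 1))⁻¹ := by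
      have := hb m (by omega)
      rw [eq_mul_inv_iff_mul_eq, mul_assoc, mul_assoc, inv_mul_eq_iff_eq_mul]
      simpa only [mul_assoc] using this.symm
    simp only [List.range_succ, List.map_append, List.reverse_append, List.prod_append,
      List.map_cons, List.map_nil, List.reverse_cons, List.reverse_nil, List.nil_append,
      List.prod_cons, List.prod_nil, mul_one]
    generalize ((List.range m).map (fun j => (t j)⁻¹)).prod = P at *
    generalize ((List.range m).reverse.map (fun j => t j)).prod = Q at *
    generalize ((List.range m).reverse.map (fun j => t (j + 1))).prod = R at *
    generalize ((List.range m).map (fun j => (t (j + 1))⁻¹)).prod = S at *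
    calc P * (t m)⁻¹ * t (m + 1) * (t m * Q) = P * ((t m)⁻¹ * t (m + 1) * t m) * Q := by group
      _ = (P * t (m + 1)) * t m * ((t (m + 1))⁻¹ * Q) := by rw [b]; group
      _ = t (m + 1) * (P * t m * Q) * (t (m + 1))⁻¹ := by
        rw [← c1.eq, c2.inv_left.eq]; group
      _ = _ := by rw [ih]; group

/-- For a chordless cycle with all edges of weight 1, the relation `t(0,1) = e`
implies the relation coming from the opposite orientation of the cycle. -/
theorem cycle_relation_opposite {G : Type*} [Group G] (d : ℕ) (hd : 3 ≤ d)
    (s : ZMod d → G)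
    (hbraid : ∀ a : ZMod d, s a * s (a + 1) * s a = s (a + 1) * s a * s (a + 1))
    (hcomm : ∀ a b : ZMod d, b ≠ a - 1 → b ≠ a → b ≠ a + 1 → s a * s b = s b * s a)
    (hc : s 0 *
        ((((List.range (d - 2)).map (fun j => (s ((j + 1 : ℕ) : ZMod d))⁻¹)).prod) *
          s ((d - 1 : ℕ) : ZMod d) *
          (((List.range (d - 2)).reverse.map (fun j => s ((j + 1 : ℕ) : ZMod d))).prod)) =
        ((((List.range (d - 2)).map (fun j => (s ((j + 1 : ℕ) : ZMod d))⁻¹)).prod) *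
          s ((d - 1 : ℕ) : ZMod d) *
          (((List.range (d - 2)).reverse.map (fun j => s ((j + 1 : ℕ) : ZMod d))).prod)) * s 0) :
    s 0 *
        ((((List.range (d - 2)).reverse.map (fun j => s ((j + 2 : ℕ) : ZMod d))).prod) *
          s 1 *
          (((List.range (d - 2)).map (fun j => (s ((j + 2 : ℕ) : ZMod d))⁻¹)).prod)) =
      ((((List.range (d - 2)).reverse.map (fun j => s ((j + 2 : ℕ) : ZMod d))).prod) *
          s 1 *
          (((List.range (d - 2)).map (fun j => (s ((j + 2 : ℕ) : ZMod d))⁻¹)).prod)) * s 0 := by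
  have key := cyc_aux (fun j => s ((j + 1 : ℕ) : ZMod d)) (d - 2)
    (fun i _ => by
      have := hbraid ((i + 1 : ℕ) : ZMod d)
      push_cast at this ⊢
      exact this)
    (fun i j h1 h2 => by
      have nd : ∀ k : ℕ, 0 < k → k < d → (k : ZMod d) ≠ 0 := by
        intro k h0 hk h
        rw [ZMod.natCast_eq_zero_iff] at h
        exact absurd (Nat.le_of_dvd h0 h) (by omega)
      obtain ⟨k, rfl⟩ := Nat.exists_eq_add_of_le h1
      apply hcomm
      · intro h
        apply nd (k + 1) (by omega) (by omega)
        push_cast at h ⊢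
        linear_combination -h
      · intro h
        apply nd (k + 2) (by omega) (by omega)
        push_cast at h ⊢
        linear_combination -h
      · intro h
        apply nd (k + 3) (by omega) (by omega)
        push_cast at h ⊢
        linear_combination -h)
  have e : d - 2 + 1 = d - 1 := by omega
  simp only [e, add_assoc, Nat.reduceAdd, zero_add, Nat.cast_one] at key
  rw [← key]
  exact hc
end

section
/- Let G be a group and let x, y, z ∈ G satisfy x·y·x = y·x·y, y·z·y·z = z·y·z·y, and z·x·z·x = x·z·x·z, and suppose z commutes with x⁻¹·y·x. Then z commutes with y·x·y⁻¹. -/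
theorem triangle_opposite_relation {G : Type*} [Group G] (x y z : G)
    (hxy : x * y * x = y * x * y)
    (hyz : y * z * y * z = z * y * z * y)
    (hzx : z * x * z * x = x * z * x * z)
    (hc : z * (x⁻¹ * y * x) = (x⁻¹ * y * x) * z) :
    z * (y * x * y⁻¹) = (y * x * y⁻¹) * z := by
  have h : y * x * y⁻¹ = x⁻¹ * y * x := by
    rw [mul_inv_eq_iff_eq_mul, mul_assoc, mul_assoc, eq_inv_mul_iff_mul_eq,
      ← mul_assoc, ← mul_assoc]
    exact hxy
  rw [h]
  exact hc
end

section
/- Let G be a group and let x, y, z ∈ G satisfy x·z·x = z·x·z, z·y·z = y·z·y, and x·y = y·x. Then the element t = z·x·z⁻¹ satisfies t·y·t = y·t·y. -/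
theorem mutation_path_weight1 {G : Type*} [Group G] (x y z : G)
    (hxz : x * z * x = z * x * z)
    (hzy : z * y * z = y * z * y)
    (hxy : x * y = y * x) :
    (z * x * z⁻¹) * y * (z * x * z⁻¹) = y * (z * x * z⁻¹) * y := by
  have ht : z * x * z⁻¹ = x⁻¹ * z * x := by
    rw [mul_inv_eq_iff_eq_mul, mul_assoc x⁻¹, mul_assoc x⁻¹, eq_inv_mul_iff_mul_eq,
      ← mul_assoc, hxz]
  have hy : y = x⁻¹ * y * x := by
    rw [mul_assoc, eq_inv_mul_iff_mul_eq, hxy]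
  rw [ht]
  calc x⁻¹ * z * x * y * (x⁻¹ * z * x)
      = x⁻¹ * z * (x * y) * x⁻¹ * z * x := by group
    _ = x⁻¹ * (z * y * z) * x := by rw [hxy]; group
    _ = (x⁻¹ * y * x) * (x⁻¹ * z * x) * (x⁻¹ * y * x) := by rw [hzy]; group
    _ = y * (x⁻¹ * z * x) * y := by rw [← hy]
end

section
/- Let G be a group and let x, y, z ∈ G satisfy x·z·x·z = z·x·z·x, z·y·z = y·z·y, and x·y = y·x. Then the element t = z·x·z⁻¹ satisfies t·y·t·y = y·t·y·t. -/
theorem mutation_path_weight2_weight1 {G : Type*} [Group G] (x y z : G)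
    (hxz : x * z * x * z = z * x * z * x)
    (hzy : z * y * z = y * z * y)
    (hxy : x * y = y * x) :
    (z * x * z⁻¹) * y * (z * x * z⁻¹) * y = y * (z * x * z⁻¹) * y * (z * x * z⁻¹) := by
  have ht : z * x * z⁻¹ = MulAut.conj (z * y) x := by
    have : x = y * x * y⁻¹ := by rw [← hxy]; group
    rw [MulAut.conj_apply]
    conv_lhs => rw [this]
    group
  have hy : y = MulAut.conj (z * y) z := by
    rw [MulAut.conj_apply, hzy]; group
  rw [ht]
  generalize hc : MulAut.conj (z * y) = c at *
  rw [hy]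
  simp only [← map_mul]
  rw [hxz]
end

section
/- Let G be a group and let x, y, z ∈ G satisfy x·z·x = z·x·z, z·y·z·y = y·z·y·z, and x·y = y·x. Then the element t = z·x·z⁻¹ satisfies t·y·t·y = y·t·y·t. -/
theorem mutation_path_weight1_weight2 {G : Type*} [Group G] (x y z : G)
    (hxz : x * z * x = z * x * z)
    (hzy : z * y * z * y = y * z * y * z)
    (hxy : x * y = y * x) :
    (z * x * z⁻¹) * y * (z * x * z⁻¹) * y = y * (z * x * z⁻¹) * y * (z * x * z⁻¹) := by
  have ht : z * x * z⁻¹ = x⁻¹ * z * x := by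
    rw [mul_inv_eq_iff_eq_mul, mul_assoc, mul_assoc, eq_inv_mul_iff_mul_eq]
    simpa only [mul_assoc] using hxz
  have hy : y = x⁻¹ * y * x := by
    rw [mul_assoc, ← hxy, inv_mul_cancel_left]
  have h1 : (x⁻¹ * z * x) * (x⁻¹ * y * x) * (x⁻¹ * z * x) * (x⁻¹ * y * x)
      = x⁻¹ * (z * y * z * y) * x := by group
  have h2 : (x⁻¹ * y * x) * (x⁻¹ * z * x) * (x⁻¹ * y * x) * (x⁻¹ * z * x)
      = x⁻¹ * (y * z * y * z) * x := by group
  rw [← hy] at h1 h2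
  rw [ht, h1, h2, hzy]
end

section
/- Let G be a group and let x, y, z ∈ G satisfy x·z·x·z = z·x·z·x, z·y·z·y = y·z·y·z, and y·x·y = x·y·x, and suppose y commutes with x⁻¹·z·x. Then the element t = z·x·z⁻¹ satisfies t·y·t = y·t·y. -/
theorem mutation_triangle_two_weight2 {G : Type*} [Group G] (x y z : G)
    (hxz : x * z * x * z = z * x * z * x)
    (hzy : z * y * z * y = y * z * y * z)
    (hyx : y * x * y = x * y * x)
    (hc : y * (x⁻¹ * z * x) = (x⁻¹ * z * x) * y) :
    (z * x * z⁻¹) * y * (z * x * z⁻¹) = y * (z * x * z⁻¹) * y := by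
  have ht : z * x * z⁻¹ = (x⁻¹ * z * x)⁻¹ * x * (x⁻¹ * z * x) := by
    have h1 : z * x * z⁻¹ = x⁻¹ * z⁻¹ * (z * x * z * x) * z⁻¹ := by group
    rw [h1, ← hxz]
    group
  rw [ht]
  generalize x⁻¹ * z * x = w at hc
  have hy : y = w⁻¹ * y * w := by
    rw [mul_assoc, hc]
    group
  calc w⁻¹ * x * w * y * (w⁻¹ * x * w)
      = w⁻¹ * x * w * (w⁻¹ * y * w) * (w⁻¹ * x * w) := by rw [← hy]
    _ = w⁻¹ * (x * y * x) * w := by group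
    _ = w⁻¹ * (y * x * y) * w := by rw [hyx]
    _ = (w⁻¹ * y * w) * (w⁻¹ * x * w) * (w⁻¹ * y * w) := by group
    _ = y * (w⁻¹ * x * w) * y := by rw [← hy]
end

section
/- Let G be a group and let s₁, s₂, s₃ ∈ G satisfy s₃·s₂·s₃·s₂ = s₂·s₃·s₂·s₃, s₂·s₁·s₂·s₁ = s₁·s₂·s₁·s₂, and s₁·s₃·s₁ = s₃·s₁·s₃, and suppose s₂ commutes with s₁⁻¹·s₃·s₁. Then s₂·s₃·s₂⁻¹ commutes with s₁⁻¹·s₂·s₁. -/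
theorem mutation_cycle_relation_case_d {G : Type*} [Group G] (s₁ s₂ s₃ : G)
    (h32 : s₃ * s₂ * s₃ * s₂ = s₂ * s₃ * s₂ * s₃)
    (h21 : s₂ * s₁ * s₂ * s₁ = s₁ * s₂ * s₁ * s₂)
    (h13 : s₁ * s₃ * s₁ = s₃ * s₁ * s₃)
    (hc : s₂ * (s₁⁻¹ * s₃ * s₁) = (s₁⁻¹ * s₃ * s₁) * s₂) :
    (s₂ * s₃ * s₂⁻¹) * (s₁⁻¹ * s₂ * s₁) = (s₁⁻¹ * s₂ * s₁) * (s₂ * s₃ * s₂⁻¹) := by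
  have e1 : s₁⁻¹ * s₂ * s₁ = (s₂ * s₁) * s₂ * (s₂ * s₁)⁻¹ := by
    rw [eq_mul_inv_iff_mul_eq]
    have : s₁⁻¹ * s₂ * s₁ * (s₂ * s₁) = s₁⁻¹ * (s₂ * s₁ * s₂ * s₁) := by group
    rw [this, h21]
    group
  have e2 : s₂ * s₃ * s₂⁻¹ = (s₂ * s₁) * (s₁⁻¹ * s₃ * s₁) * (s₂ * s₁)⁻¹ := by group
  rw [e1, e2]
  generalize s₁⁻¹ * s₃ * s₁ = x at hc
  generalize s₂ * s₁ = g
  have l : g * x * g⁻¹ * (g * s₂ * g⁻¹) = g * (x * s₂) * g⁻¹ := by group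
  have r : g * s₂ * g⁻¹ * (g * x * g⁻¹) = g * (s₂ * x) * g⁻¹ := by group
  rw [l, r, hc]
end

section
/- Let G be a group and let s₁, s₂, s₃, s₄ ∈ G satisfy s₁·s₂·s₁ = s₂·s₁·s₂, s₄·s₁·s₄·s₁ = s₁·s₄·s₁·s₄, s₄·s₂·s₄·s₂ = s₂·s₄·s₂·s₄, s₂·s₃·s₂·s₃ = s₃·s₂·s₃·s₂, s₃·s₄·s₃ = s₄·s₃·s₄, and s₁·s₃ = s₃·s₁, and suppose s₂ commutes with s₃⁻¹·s₄·s₃. Then s₁ commutes with (s₁·s₂⁻¹·s₁⁻¹)·s₃⁻¹·s₄·s₃·(s₁·s₂·s₁⁻¹). -/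
theorem mutation_cycle_relation_case_e {G : Type*} [Group G] (s₁ s₂ s₃ s₄ : G)
    (h12 : s₁ * s₂ * s₁ = s₂ * s₁ * s₂)
    (h41 : s₄ * s₁ * s₄ * s₁ = s₁ * s₄ * s₁ * s₄)
    (h42 : s₄ * s₂ * s₄ * s₂ = s₂ * s₄ * s₂ * s₄)
    (h23 : s₂ * s₃ * s₂ * s₃ = s₃ * s₂ * s₃ * s₂)
    (h34 : s₃ * s₄ * s₃ = s₄ * s₃ * s₄)
    (h13 : s₁ * s₃ = s₃ * s₁)
    (hc : s₂ * (s₃⁻¹ * s₄ * s₃) = (s₃⁻¹ * s₄ * s₃) * s₂) :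
    s₁ * ((s₁ * s₂⁻¹ * s₁⁻¹) * s₃⁻¹ * s₄ * s₃ * (s₁ * s₂ * s₁⁻¹)) =
      ((s₁ * s₂⁻¹ * s₁⁻¹) * s₃⁻¹ * s₄ * s₃ * (s₁ * s₂ * s₁⁻¹)) * s₁ := by 
  have h : s₁ = (s₁ * s₂ * s₁⁻¹)⁻¹ * s₂ * (s₁ * s₂ * s₁⁻¹) := by
    have e : s₂ * (s₁ * s₂ * s₁⁻¹) = s₁ * s₂ := by
      rw [← mul_assoc, ← mul_assoc, ← h12]; group
    rw [mul_assoc, e]; group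
  have hY : (s₁ * s₂⁻¹ * s₁⁻¹) * s₃⁻¹ * s₄ * s₃ * (s₁ * s₂ * s₁⁻¹)
      = (s₁ * s₂ * s₁⁻¹)⁻¹ * (s₃⁻¹ * s₄ * s₃) * (s₁ * s₂ * s₁⁻¹) := by group
  rw [hY]
  generalize s₁ * s₂ * s₁⁻¹ = g at h
  generalize s₃⁻¹ * s₄ * s₃ = X at hc
  rw [h]
  calc g⁻¹ * s₂ * g * (g⁻¹ * X * g) = g⁻¹ * (s₂ * X) * g := by group
    _ = g⁻¹ * (X * s₂) * g := by rw [hc]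
    _ = g⁻¹ * X * g * (g⁻¹ * s₂ * g) := by group
end
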